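/- arXiv:1606.02044 — 2 statements merged into one kernel-verified Lean document; each statement's English description precedes it below -/
import Mathlib

section
/- Let v > 0 be a real number and let Ψ(v) = Γ'(v)/Γ(v) denote the digamma function, where Γ is the real gamma function. Then the series Σ_{n=1}^∞ |G_n| (n−1)! / (v(v+1)(v+2)···(v+n−1)) converges and Ψ(v) = ln v − Σ_{n=1}^∞ |G_n| (n−1)! / (v(v+1)(v+2)···(v+n−1)). -/
open Filter Finset intervalIntegral

/-- Gregory's coefficients `G_n = ∫₀¹ x(x−1)⋯(x−n+1)/n! dx`. -/
noncomputable def gregoryG (n : ℕ) : ℝ :=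
  ∫ x in (0:ℝ)..1, (∏ i ∈ Finset.range n, (x - (i : ℝ))) / (n.factorial : ℝ)

/-- The function `x(1-x)(2-x)⋯(n-x)`, nonnegative on `[0,1]`. -/
noncomputable def gregoryKernel (n : ℕ) (x : ℝ) : ℝ :=
  x * ∏ i ∈ Finset.range n, ((i : ℝ) + 1 - x)

/-- The rising factorial `v(v+1)⋯(v+n)`. -/
noncomputable def risingProd (v : ℝ) (n : ℕ) : ℝ :=
  ∏ i ∈ Finset.range (n + 1), (v + (i : ℝ))

/-- The general term of the Binet–Nørlund series. -/
noncomputable def gregoryTerm (v : ℝ) (n : ℕ) : ℝ :=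
  |gregoryG (n + 1)| * (n.factorial : ℝ) / risingProd v n

lemma gregoryKernel_succ (n : ℕ) (x : ℝ) :
    gregoryKernel (n + 1) x = gregoryKernel n x * ((n : ℝ) + 1 - x) := by
  simp [gregoryKernel, Finset.prod_range_succ, mul_assoc]

lemma continuous_gregoryKernel (n : ℕ) : Continuous (gregoryKernel n) := by
  unfold gregoryKernel
  fun_prop

lemma prod_range_sub_eq_gregoryKernel (n : ℕ) (x : ℝ) :
    ∏ i ∈ Finset.range (n + 1), (x - (i : ℝ)) = (-1) ^ n * gregoryKernel n x := by
  induction n with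
  | zero => simp [gregoryKernel]
  | succ n ih =>
    rw [Finset.prod_range_succ, ih, gregoryKernel_succ]
    push_cast
    ring

lemma gregoryKernel_nonneg (n : ℕ) {x : ℝ} (hx : x ∈ Set.Icc (0 : ℝ) 1) :
    0 ≤ gregoryKernel n x :=
  mul_nonneg hx.1 <| Finset.prod_nonneg fun i _ => by
    have := hx.2
    have : (0 : ℝ) ≤ i := i.cast_nonneg
    linarith

lemma gregoryKernel_le_factorial (n : ℕ) {x : ℝ} (hx : x ∈ Set.Icc (0 : ℝ) 1) :
    gregoryKernel n x ≤ n.factorial := by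
  induction n with
  | zero => simpa [gregoryKernel] using hx.2
  | succ n ih =>
    rw [gregoryKernel_succ, Nat.factorial_succ, mul_comm]
    push_cast
    have := hx.1
    exact mul_le_mul (by linarith) ih (gregoryKernel_nonneg n hx) (by positivity)

lemma abs_gregoryG_succ (n : ℕ) :
    |gregoryG (n + 1)| = (∫ x in (0:ℝ)..1, gregoryKernel n x) / ((n + 1).factorial : ℝ) := by
  have h : 0 ≤ ∫ x in (0:ℝ)..1, gregoryKernel n x :=
    intervalIntegral.integral_nonneg zero_le_one fun x hx => gregoryKernel_nonneg n hx
  simp only [gregoryG, prod_range_sub_eq_gregoryKernel, intervalIntegral.integral_div,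
    intervalIntegral.integral_const_mul]
  rw [abs_div, abs_mul, abs_pow, abs_neg, abs_one, one_pow, one_mul, abs_of_nonneg h,
    abs_of_nonneg (Nat.cast_nonneg _)]

lemma risingProd_pos {v : ℝ} (hv : 0 < v) (n : ℕ) : 0 < risingProd v n :=
  Finset.prod_pos fun i _ => by positivity

lemma risingProd_succ (v : ℝ) (n : ℕ) :
    risingProd v (n + 1) = risingProd v n * (v + n + 1) := by
  rw [risingProd, Finset.prod_range_succ, risingProd]
  push_cast
  ring

lemma risingProd_succ' (v : ℝ) (n : ℕ) :
    risingProd v (n + 1) = v * risingProd (v + 1) n := by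
  rw [risingProd, Finset.prod_range_succ', mul_comm, risingProd]
  congr 1
  · simp
  · refine Finset.prod_congr rfl fun i _ => ?_
    push_cast
    ring

lemma gregoryTerm_eq (v : ℝ) (n : ℕ) :
    gregoryTerm v n =
      (∫ x in (0:ℝ)..1, gregoryKernel n x) / (((n : ℝ) + 1) * risingProd v n) := by
  have : (n.factorial : ℝ) ≠ 0 := by positivity
  rw [gregoryTerm, abs_gregoryG_succ, Nat.factorial_succ]
  push_cast
  rw [div_mul_eq_mul_div, div_div, mul_right_comm, mul_div_mul_right _ _ this]

lemma gregoryTerm_nonneg {v : ℝ} (hv : 0 < v) (n : ℕ) : 0 ≤ gregoryTerm v n := by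
  have := risingProd_pos hv n
  unfold gregoryTerm
  positivity

lemma gregoryTerm_le {v : ℝ} (hv : 0 < v) (n : ℕ) :
    gregoryTerm v n ≤ (n.factorial : ℝ) / (((n : ℝ) + 1) * risingProd v n) := by
  have := risingProd_pos hv n
  rw [gregoryTerm_eq]
  gcongr
  calc ∫ x in (0:ℝ)..1, gregoryKernel n x ≤ ∫ _ in (0:ℝ)..1, (n.factorial : ℝ) :=
        intervalIntegral.integral_mono_on zero_le_one
          ((continuous_gregoryKernel n).intervalIntegrable _ _)
          (continuous_const.intervalIntegrable _ _) fun x hx => gregoryKernel_le_factorial n hx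
    _ = n.factorial := by simp

lemma sum_gregoryTerm_le {v : ℝ} (hv : 0 < v) (N : ℕ) :
    ∑ n ∈ Finset.range N, gregoryTerm v n ≤ (v + 1) / v ^ 2 := by
  suffices h : ∑ n ∈ Finset.range N, gregoryTerm v n ≤
      (v + 1) / v * (1 / v - (N.factorial : ℝ) / risingProd v N) by
    have h0 : 0 ≤ (v + 1) / v * ((N.factorial : ℝ) / risingProd v N) := by
      have := risingProd_pos hv N
      positivity
    calc _ ≤ _ := h
      _ ≤ (v + 1) / v * (1 / v) := by linarith
      _ = _ := by field_simp
  induction N with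
  | zero => simp [risingProd]
  | succ N ih =>
    rw [Finset.sum_range_succ]
    refine (add_le_add ih (gregoryTerm_le hv N)).trans ?_
    have hp := risingProd_pos hv N
    have hf : (0 : ℝ) < N.factorial := by positivity
    rw [risingProd_succ, Nat.factorial_succ]
    push_cast
    have key : (N.factorial : ℝ) / (((N : ℝ) + 1) * risingProd v N) ≤
        (N.factorial : ℝ) * (v + 1) / (risingProd v N * (v + N + 1)) := by
      rw [div_le_div_iff₀ (by positivity) (by positivity)]
      have : (v + N + 1) ≤ (v + 1) * (N + 1) := by
        nlinarith [mul_nonneg hv.le (Nat.cast_nonneg (α := ℝ) N)]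
      calc (N.factorial : ℝ) * (risingProd v N * (v + N + 1))
          ≤ N.factorial * (risingProd v N * ((v + 1) * (N + 1))) := by gcongr
        _ = _ := by ring
    refine (add_le_add_right key _).trans (le_of_eq ?_)
    field_simp
    ring

lemma summable_gregoryTerm {v : ℝ} (hv : 0 < v) : Summable (gregoryTerm v) :=
  summable_of_sum_range_le (gregoryTerm_nonneg hv) (sum_gregoryTerm_le hv)

lemma tsum_gregoryTerm_le {v : ℝ} (hv : 0 < v) : ∑' n, gregoryTerm v n ≤ (v + 1) / v ^ 2 :=
  Real.tsum_le_of_sum_range_le (gregoryTerm_nonneg hv) (sum_gregoryTerm_le hv)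

lemma tendsto_factorial_div_risingProd {v : ℝ} (hv : 0 < v) :
    Tendsto (fun n : ℕ => (n.factorial : ℝ) / risingProd v n) atTop (nhds 0) := by
  have h : Tendsto (fun n : ℕ => ((n : ℝ) ^ v)⁻¹) atTop (nhds 0) :=
    ((tendsto_rpow_atTop hv).comp tendsto_natCast_atTop_atTop).inv_tendsto_atTop
  have h2 := (Real.GammaSeq_tendsto_Gamma v).mul h
  rw [mul_zero] at h2
  refine h2.congr' ?_
  filter_upwards [eventually_gt_atTop 0] with n hn
  have : (n : ℝ) ^ v ≠ 0 := (Real.rpow_pos_of_pos (by exact_mod_cast hn) v).ne'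
  rw [Real.GammaSeq, risingProd]
  field_simp

lemma intervalIntegrable_gregoryKernel_div {v : ℝ} (hv : 0 < v) (n : ℕ) :
    IntervalIntegrable (fun x => gregoryKernel n x / (v + x)) MeasureTheory.volume 0 1 := by
  refine ContinuousOn.intervalIntegrable ?_
  rw [Set.uIcc_of_le zero_le_one]
  refine (continuous_gregoryKernel n).continuousOn.div (by fun_prop) fun x hx => ?_
  have := hx.1
  positivity

lemma integral_gregoryKernel_div_succ {v : ℝ} (hv : 0 < v) (n : ℕ) :
    ∫ x in (0:ℝ)..1, gregoryKernel (n + 1) x / (v + x) =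
      (v + n + 1) * (∫ x in (0:ℝ)..1, gregoryKernel n x / (v + x)) -
        ∫ x in (0:ℝ)..1, gregoryKernel n x := by
  rw [← intervalIntegral.integral_const_mul, ← intervalIntegral.integral_sub
    ((intervalIntegrable_gregoryKernel_div hv n).const_mul _)
    ((continuous_gregoryKernel n).intervalIntegrable _ _)]
  refine intervalIntegral.integral_congr fun x hx => ?_
  rw [Set.uIcc_of_le zero_le_one] at hx
  have : v + x ≠ 0 := by
    have := hx.1
    positivity
  simp only [gregoryKernel_succ]
  field_simp
  ring

lemma gregoryTerm_sub_gregoryTerm_add_one {v : ℝ} (hv : 0 < v) (n : ℕ) :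
    gregoryTerm v n - gregoryTerm (v + 1) n =
      (∫ x in (0:ℝ)..1, gregoryKernel n x / (v + x)) / risingProd v n -
        (∫ x in (0:ℝ)..1, gregoryKernel (n + 1) x / (v + x)) / risingProd v (n + 1) := by
  have hp := (risingProd_pos hv n).ne'
  have hw : v + n + 1 ≠ 0 := by positivity
  have hn : (n : ℝ) + 1 ≠ 0 := by positivity
  have h1 : risingProd (v + 1) n = risingProd v n * (v + n + 1) / v := by
    rw [← risingProd_succ, risingProd_succ']
    field_simp
  rw [gregoryTerm_eq, gregoryTerm_eq, integral_gregoryKernel_div_succ hv, risingProd_succ, h1]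
  field_simp
  ring

lemma integral_gregoryKernel_zero_div {v : ℝ} (hv : 0 < v) :
    ∫ x in (0:ℝ)..1, gregoryKernel 0 x / (v + x) =
      1 - v * (Real.log (v + 1) - Real.log v) := by
  have hd : ∀ x ∈ Set.uIcc (0 : ℝ) 1,
      HasDerivAt (fun x => x - v * Real.log (v + x)) (gregoryKernel 0 x / (v + x)) x := by
    intro x hx
    rw [Set.uIcc_of_le zero_le_one] at hx
    have h : v + x ≠ 0 := by
      have := hx.1
      positivity
    have hf : gregoryKernel 0 x / (v + x) = 1 - v * (1 / (v + x)) := by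
      simp only [gregoryKernel, Finset.range_zero, Finset.prod_empty]
      field_simp
      ring
    rw [hf]
    exact (hasDerivAt_id x).sub ((((hasDerivAt_id x).const_add v).log h).const_mul v)
  rw [intervalIntegral.integral_eq_sub_of_hasDerivAt hd
    (intervalIntegrable_gregoryKernel_div hv 0)]
  simp
  ring

lemma tendsto_integral_gregoryKernel_div {v : ℝ} (hv : 0 < v) :
    Tendsto (fun n => (∫ x in (0:ℝ)..1, gregoryKernel n x / (v + x)) / risingProd v n)
      atTop (nhds 0) := by
  have h := (tendsto_factorial_div_risingProd hv).const_mul v⁻¹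
  rw [mul_zero] at h
  refine squeeze_zero (fun n => ?_) (fun n => ?_) h
  · refine div_nonneg (intervalIntegral.integral_nonneg zero_le_one fun x hx => ?_)
      (risingProd_pos hv n).le
    exact div_nonneg (gregoryKernel_nonneg n hx) (add_nonneg hv.le hx.1)
  · have hp := risingProd_pos hv n
    rw [← mul_div_assoc]
    gcongr
    calc ∫ x in (0:ℝ)..1, gregoryKernel n x / (v + x)
        ≤ ∫ _ in (0:ℝ)..1, v⁻¹ * (n.factorial : ℝ) := by
          refine intervalIntegral.integral_mono_on zero_le_one
            (intervalIntegrable_gregoryKernel_div hv n)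
            (continuous_const.intervalIntegrable _ _) fun x hx => ?_
          rw [inv_mul_eq_div]
          exact div_le_div₀ (by positivity) (gregoryKernel_le_factorial n hx) hv
            (le_add_of_nonneg_right hx.1)
      _ = v⁻¹ * n.factorial := by simp

lemma tsum_gregoryTerm_add_one {v : ℝ} (hv : 0 < v) :
    ∑' n, gregoryTerm (v + 1) n =
      ∑' n, gregoryTerm v n - (1 / v - (Real.log (v + 1) - Real.log v)) := by
  have h1 := ((summable_gregoryTerm hv).hasSum.sub
    (summable_gregoryTerm (add_pos hv one_pos)).hasSum).tendsto_sum_nat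
  simp only [gregoryTerm_sub_gregoryTerm_add_one hv, Finset.sum_range_sub'] at h1
  have h2 := tendsto_nhds_unique h1 ((tendsto_integral_gregoryKernel_div hv).const_sub _)
  rw [integral_gregoryKernel_zero_div hv] at h2
  have h3 : (1 - v * (Real.log (v + 1) - Real.log v)) / risingProd v 0 =
      1 / v - (Real.log (v + 1) - Real.log v) := by
    simp only [risingProd, zero_add, Finset.range_one, Finset.prod_singleton, Nat.cast_zero,
      add_zero]
    field_simp
  rw [h3] at h2
  linarith

lemma deriv_log_Gamma {v : ℝ} (hv : 0 < v) :
    deriv (Real.log ∘ Real.Gamma) v = deriv Real.Gamma v / Real.Gamma v := by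
  rw [Function.comp_def, deriv.log (Real.differentiableAt_Gamma fun m => by
    have : (0 : ℝ) ≤ m := m.cast_nonneg
    linarith) (Real.Gamma_pos_of_pos hv).ne']

lemma differentiableAt_log_Gamma {v : ℝ} (hv : 0 < v) :
    DifferentiableAt ℝ (Real.log ∘ Real.Gamma) v :=
  (Real.differentiableAt_Gamma fun m => by
    have : (0 : ℝ) ≤ m := m.cast_nonneg
    linarith).log (Real.Gamma_pos_of_pos hv).ne'

lemma log_Gamma_add_one {v : ℝ} (hv : 0 < v) :
    (Real.log ∘ Real.Gamma) (v + 1) = (Real.log ∘ Real.Gamma) v + Real.log v := by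
  simp only [Function.comp_apply, Real.Gamma_add_one hv.ne',
    Real.log_mul hv.ne' (Real.Gamma_pos_of_pos hv).ne', add_comm]

lemma deriv_log_Gamma_add_one {v : ℝ} (hv : 0 < v) :
    deriv (Real.log ∘ Real.Gamma) (v + 1) = deriv (Real.log ∘ Real.Gamma) v + 1 / v := by
  rw [← deriv_comp_add_const, one_div, ← Real.deriv_log,
    ← deriv_add (differentiableAt_log_Gamma hv) (Real.differentiableAt_log hv.ne')]
  apply EventuallyEq.deriv_eq
  filter_upwards [eventually_gt_nhds hv] with x hx using log_Gamma_add_one hx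

lemma deriv_log_Gamma_le_log {v : ℝ} (hv : 0 < v) :
    deriv (Real.log ∘ Real.Gamma) v ≤ Real.log v := by
  refine (Real.convexOn_log_Gamma.deriv_le_slope hv (add_pos hv one_pos) (lt_add_one v)
    (differentiableAt_log_Gamma hv)).trans (le_of_eq ?_)
  rw [slope_def_field, log_Gamma_add_one hv]
  ring

lemma log_sub_le_deriv_log_Gamma {v : ℝ} (hv : 0 < v) :
    Real.log v - 1 / v ≤ deriv (Real.log ∘ Real.Gamma) v := by
  rw [sub_le_iff_le_add, ← deriv_log_Gamma_add_one hv]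
  have h1 := add_pos hv one_pos
  refine (le_of_eq ?_).trans (Real.convexOn_log_Gamma.slope_le_deriv hv h1 (lt_add_one v)
    (differentiableAt_log_Gamma h1))
  rw [slope_def_field, log_Gamma_add_one hv]
  ring

/-- The difference between the two sides of the Binet–Nørlund expansion. -/
noncomputable def binetDefect (v : ℝ) : ℝ :=
  deriv (Real.log ∘ Real.Gamma) v - Real.log v + ∑' n, gregoryTerm v n

lemma binetDefect_add_natCast {v : ℝ} (hv : 0 < v) (k : ℕ) :
    binetDefect (v + k) = binetDefect v := by
  induction k with
  | zero => simp
  | succ k ih =>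
    have h : 0 < v + k := by positivity
    rw [Nat.cast_succ, ← add_assoc, ← ih, binetDefect, deriv_log_Gamma_add_one h,
      tsum_gregoryTerm_add_one h, binetDefect]
    ring

lemma tendsto_binetDefect_atTop : Tendsto binetDefect atTop (nhds 0) := by
  have h1 : Tendsto (fun v : ℝ => v⁻¹) atTop (nhds 0) := tendsto_inv_atTop_zero
  have hl : Tendsto (fun v : ℝ => -v⁻¹) atTop (nhds 0) := by simpa using h1.neg
  have hu : Tendsto (fun v : ℝ => v⁻¹ + v⁻¹ * v⁻¹) atTop (nhds 0) := by
    simpa using h1.add (h1.mul h1)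
  refine tendsto_of_tendsto_of_tendsto_of_le_of_le' hl hu ?_ ?_
  · filter_upwards [eventually_gt_atTop 0] with v hv
    have := log_sub_le_deriv_log_Gamma hv
    have := (tsum_nonneg (gregoryTerm_nonneg hv) : 0 ≤ ∑' n, gregoryTerm v n)
    rw [one_div] at *
    unfold binetDefect
    linarith
  · filter_upwards [eventually_gt_atTop 0] with v hv
    have := deriv_log_Gamma_le_log hv
    have := tsum_gregoryTerm_le hv
    have : (v + 1) / v ^ 2 = v⁻¹ + v⁻¹ * v⁻¹ := by field_simp
    unfold binetDefect
    linarith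

lemma binetDefect_eq_zero {v : ℝ} (hv : 0 < v) : binetDefect v = 0 := by
  have h : Tendsto (fun k : ℕ => binetDefect (v + k)) atTop (nhds 0) :=
    tendsto_binetDefect_atTop.comp
      (tendsto_atTop_add_const_left _ v tendsto_natCast_atTop_atTop)
  simp only [binetDefect_add_natCast hv] at h
  exact tendsto_nhds_unique tendsto_const_nhds h

/-- Binet–Nørlund expansion of the digamma function with Gregory's coefficients:
for real `v > 0`, the series `Σ_{n=1}^∞ |G_n| (n−1)!/(v(v+1)⋯(v+n−1))` converges and
`Ψ(v) = ln v − Σ_{n=1}^∞ |G_n| (n−1)!/(v(v+1)⋯(v+n−1))`, where `Ψ = Γ'/Γ`. -/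
theorem digamma_gregory_series (v : ℝ) (hv : 0 < v) :
    ∃ L : ℝ,
      Tendsto (fun N : ℕ => ∑ n ∈ Finset.range N,
          |gregoryG (n + 1)| * (n.factorial : ℝ) / (∏ i ∈ Finset.range (n + 1), (v + (i : ℝ))))
        atTop (nhds L) ∧
      deriv Real.Gamma v / Real.Gamma v = Real.log v - L := by
  refine ⟨∑' n, gregoryTerm v n, (summable_gregoryTerm hv).hasSum.tendsto_sum_nat, ?_⟩
  have h := binetDefect_eq_zero hv
  rw [binetDefect] at h
  rw [← deriv_log_Gamma hv]
  linarith
end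

section
/- Let v > 0 be a real number. Then the series Σ_{n=0}^∞ |G_{n+1}| Σ_{k=0}^n (−1)^k C(n,k) ln(k+v) converges and ln Γ(v) = v ln v − v + (1/2) ln(2π) − Σ_{n=0}^∞ |G_{n+1}| Σ_{k=0}^n (−1)^k C(n,k) ln(k+v), where Γ is the real gamma function. -/
open Filter Finset intervalIntegral

/-- The alternating binomial sum `Σ_{k=0}^n (−1)^k C(n,k) f(k+v)`. -/
noncomputable def alternatingDiff (f : ℝ → ℝ) (n : ℕ) (v : ℝ) : ℝ :=
  ∑ k ∈ Finset.range (n + 1), (-1 : ℝ) ^ k * (n.choose k : ℝ) * f ((k : ℝ) + v)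

theorem alternatingDiff_zero (f : ℝ → ℝ) (v : ℝ) : alternatingDiff f 0 v = f v := by
  simp [alternatingDiff]

theorem alternatingDiff_eq_fwdDiff (f : ℝ → ℝ) (n : ℕ) (v : ℝ) :
    alternatingDiff f n v = (-1) ^ n * ((fwdDiff (1 : ℝ))^[n] f) v := by
  rw [fwdDiff_iter_eq_sum_shift, Finset.mul_sum]
  refine Finset.sum_congr rfl fun k hk => ?_
  have hkn : k ≤ n := by simpa [Nat.lt_succ_iff] using hk
  obtain ⟨m, rfl⟩ := Nat.exists_eq_add_of_le hkn
  have hm : ((-1 : ℝ) ^ m) * (-1) ^ m = 1 := by rw [← mul_pow]; simp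
  simp only [add_tsub_cancel_left, zsmul_eq_mul, nsmul_eq_mul, mul_one, add_comm v]
  push_cast
  rw [pow_add]
  linear_combination (-(-1 : ℝ) ^ k * ((k + m).choose k) * f (k + v)) * hm

theorem alternatingDiff_succ (f : ℝ → ℝ) (n : ℕ) (v : ℝ) :
    alternatingDiff f (n + 1) v = alternatingDiff f n v - alternatingDiff f n (v + 1) := by
  simp only [alternatingDiff_eq_fwdDiff, Function.iterate_succ_apply', fwdDiff]
  ring

theorem alternatingDiff_inv (n : ℕ) {v : ℝ} (hv : 0 < v) :
    alternatingDiff (fun t => t⁻¹) n v =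
      (n.factorial : ℝ) / ∏ i ∈ Finset.range (n + 1), (v + i) := by
  induction n generalizing v with
  | zero => simp [alternatingDiff_zero]
  | succ n ih =>
    rw [alternatingDiff_succ, ih hv, ih (by positivity : 0 < v + 1)]
    have hprod : 0 < ∏ i ∈ Finset.range n, (v + 1 + (i : ℝ)) :=
      Finset.prod_pos fun i _ => by positivity
    have hshift : ∀ m : ℕ, ∏ i ∈ Finset.range (m + 1), (v + (i : ℝ)) =
        v * ∏ i ∈ Finset.range m, (v + 1 + (i : ℝ)) := fun m => by
      rw [Finset.prod_range_succ', mul_comm]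
      simp [add_assoc, add_comm (1 : ℝ)]
    rw [hshift, hshift, Finset.prod_range_succ, Nat.factorial_succ]
    have hn : 0 < v + 1 + (n : ℝ) := by positivity
    push_cast
    field_simp
    ring

theorem hasDerivAt_alternatingDiff_log (n : ℕ) {v : ℝ} (hv : 0 < v) :
    HasDerivAt (alternatingDiff Real.log n) (alternatingDiff (fun t => t⁻¹) n v) v := by
  unfold alternatingDiff
  refine HasDerivAt.fun_sum fun k _ => HasDerivAt.const_mul _ ?_
  have hk : (k : ℝ) + v ≠ 0 := by positivity
  simpa using (((hasDerivAt_id v).const_add (k : ℝ)).log hk)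

theorem tendsto_log_add_sub_log (x : ℝ) :
    Tendsto (fun t : ℝ => Real.log (t + x) - Real.log t) atTop (nhds 0) := by
  have h : Tendsto (fun t : ℝ => Real.log (1 + x / t)) atTop (nhds 0) := by
    have h1 : Tendsto (fun t : ℝ => 1 + x / t) atTop (nhds (1 + 0)) :=
      (tendsto_const_nhds.div_atTop tendsto_id).const_add 1
    rw [add_zero] at h1
    simpa using h1.log one_ne_zero
  refine h.congr' ?_
  filter_upwards [eventually_gt_atTop 0, eventually_gt_atTop (-x)] with t ht htx
  have : t + x ≠ 0 := by linarith
  rw [← Real.log_div this ht.ne']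
  congr 1
  field_simp

theorem tendsto_alternatingDiff_log (n : ℕ) :
    Tendsto (alternatingDiff Real.log (n + 1)) atTop (nhds 0) := by
  induction n with
  | zero =>
    have h := (tendsto_log_add_sub_log 1).neg
    rw [neg_zero] at h
    refine h.congr fun t => ?_
    rw [alternatingDiff_succ, alternatingDiff_zero, alternatingDiff_zero]
    ring
  | succ n ih =>
    have h := ih.sub (ih.comp (tendsto_atTop_add_const_right _ (1 : ℝ) tendsto_id))
    rw [sub_zero] at h
    exact h.congr fun t => (alternatingDiff_succ _ _ _).symm

/-- The remainder of the Newton interpolation series of `Real.log` at `v`, evaluated at `v + x`. -/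
noncomputable def logNewtonRemainder (N : ℕ) (x v : ℝ) : ℝ :=
  Real.log (v + x) - ∑ n ∈ Finset.range N,
    (∏ i ∈ Finset.range n, (x - (i : ℝ))) / (n.factorial : ℝ) *
      ((-1) ^ n * alternatingDiff Real.log n v)

theorem inv_sub_newton_sum (N : ℕ) {x v : ℝ} (hx : 0 ≤ x) (hv : 0 < v) :
    (v + x)⁻¹ - ∑ n ∈ Finset.range N,
      (∏ i ∈ Finset.range n, (x - (i : ℝ))) / (n.factorial : ℝ) *
        ((-1) ^ n * alternatingDiff (fun t => t⁻¹) n v) =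
    (-1) ^ N * (∏ i ∈ Finset.range N, (x - (i : ℝ))) /
      ((∏ i ∈ Finset.range N, (v + i)) * (v + x)) := by
  induction N with
  | zero => simp
  | succ N ih =>
    rw [Finset.sum_range_succ, ← sub_sub, ih, alternatingDiff_inv N hv, Finset.prod_range_succ,
      Finset.prod_range_succ (fun i : ℕ => x - (i : ℝ))]
    have hprod : 0 < ∏ i ∈ Finset.range N, (v + (i : ℝ)) :=
      Finset.prod_pos fun i _ => by positivity
    have hN : 0 < v + (N : ℝ) := by positivity
    have hvx : 0 < v + x := by positivity
    field_simp
    ring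

theorem hasDerivAt_logNewtonRemainder (N : ℕ) {x v : ℝ} (hx : 0 ≤ x) (hv : 0 < v) :
    HasDerivAt (logNewtonRemainder N x)
      ((-1) ^ N * (∏ i ∈ Finset.range N, (x - (i : ℝ))) /
        ((∏ i ∈ Finset.range N, (v + i)) * (v + x))) v := by
  rw [← inv_sub_newton_sum N hx hv]
  have hvx : v + x ≠ 0 := by positivity
  refine HasDerivAt.sub ?_ (HasDerivAt.fun_sum fun n _ =>
    ((hasDerivAt_alternatingDiff_log n hv).const_mul _).const_mul _)
  simpa using ((hasDerivAt_id v).add_const x).log hvx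

theorem tendsto_logNewtonRemainder (M : ℕ) (x : ℝ) :
    Tendsto (logNewtonRemainder (M + 1) x) atTop (nhds 0) := by
  have h := (tendsto_log_add_sub_log x).sub (tendsto_finsetSum (Finset.range M) fun n _ =>
    ((tendsto_alternatingDiff_log n).const_mul ((-1) ^ (n + 1))).const_mul
      ((∏ i ∈ Finset.range (n + 1), (x - (i : ℝ))) / ((n + 1).factorial : ℝ)))
  simp only [mul_zero, Finset.sum_const_zero, sub_zero] at h
  refine h.congr fun t => ?_
  rw [logNewtonRemainder, Finset.sum_range_succ']
  simp only [Finset.range_zero, Finset.prod_empty, Nat.factorial_zero, Nat.cast_one, div_one,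
    pow_zero, one_mul, alternatingDiff_zero]
  ring

theorem neg_one_pow_mul_prod_range_sub {x : ℝ} (hx : x ∈ Set.Icc (0 : ℝ) 1) (n : ℕ) :
    0 ≤ (-1) ^ n * ∏ i ∈ Finset.range (n + 1), (x - (i : ℝ)) ∧
      (-1) ^ n * ∏ i ∈ Finset.range (n + 1), (x - (i : ℝ)) ≤ n.factorial := by
  induction n with
  | zero => simpa using hx
  | succ n ih =>
    obtain ⟨h0, h1⟩ := ih
    have hfac : 0 ≤ (n : ℝ) + 1 - x := by
      have := hx.2
      have : (0 : ℝ) ≤ n := n.cast_nonneg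
      linarith
    have e : (-1) ^ (n + 1) * ∏ i ∈ Finset.range (n + 1 + 1), (x - (i : ℝ)) =
        ((n : ℝ) + 1 - x) * ((-1) ^ n * ∏ i ∈ Finset.range (n + 1), (x - (i : ℝ))) := by
      rw [Finset.prod_range_succ _ (n + 1), pow_succ]
      push_cast
      ring
    rw [e, Nat.factorial_succ]
    push_cast
    refine ⟨mul_nonneg hfac h0, mul_le_mul ?_ h1 h0 (by positivity)⟩
    linarith [hx.1]

/-- Rate of decay in `M` of the Newton remainder of order `M + 2`, uniform on `[v, ∞)`. -/
noncomputable def newtonRate (v : ℝ) (M : ℕ) : ℝ :=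
  ((M + 1).factorial : ℝ) / ∏ i ∈ Finset.range M, (v + (i + 2))

theorem prod_range_add_two_add (M : ℕ) (t : ℝ) :
    ∏ i ∈ Finset.range (M + 2), (t + (i : ℝ)) =
      t * (t + 1) * ∏ i ∈ Finset.range M, (t + ((i : ℝ) + 2)) := by
  rw [Finset.prod_range_succ', Finset.prod_range_succ']
  push_cast
  simp only [add_assoc, add_zero]
  norm_num
  ring

theorem newtonRate_pos {v : ℝ} (hv : 0 < v) (M : ℕ) : 0 < newtonRate v M :=
  div_pos (by positivity) (Finset.prod_pos fun i _ => by positivity)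

theorem tendsto_newtonRate {v : ℝ} (hv : 0 < v) :
    Tendsto (newtonRate v) atTop (nhds 0) := by
  have h := ((Real.GammaSeq_tendsto_Gamma v).div_atTop
    ((tendsto_rpow_atTop hv).comp tendsto_natCast_atTop_atTop)).mul_const (v * (v + 1))
  rw [zero_mul] at h
  refine (h.comp (tendsto_add_atTop_nat 1)).congr fun M => ?_
  have hpow : 0 < ((M + 1 : ℕ) : ℝ) ^ v := by positivity
  have hprod : 0 < ∏ i ∈ Finset.range M, (v + ((i : ℝ) + 2)) :=
    Finset.prod_pos fun i _ => by positivity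
  simp only [Function.comp_apply, Real.GammaSeq, newtonRate]
  rw [prod_range_add_two_add]
  field_simp

theorem abs_deriv_logNewtonRemainder_le (M : ℕ) {x v t : ℝ} (hx : x ∈ Set.Icc (0 : ℝ) 1)
    (hv : 0 < v) (hvt : v ≤ t) :
    |(-1) ^ (M + 2) * (∏ i ∈ Finset.range (M + 2), (x - (i : ℝ))) /
        ((∏ i ∈ Finset.range (M + 2), (t + i)) * (t + x))| ≤
      newtonRate v M * (1 / t ^ 2 - 1 / (t + 1) ^ 2) := by
  have ht : 0 < t := hv.trans_le hvt
  have hx0 := hx.1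
  obtain ⟨h0, h1⟩ := neg_one_pow_mul_prod_range_sub hx (M + 1)
  have hP : 0 < ∏ i ∈ Finset.range M, (v + ((i : ℝ) + 2)) :=
    Finset.prod_pos fun i _ => by positivity
  have hPt : ∏ i ∈ Finset.range M, (v + ((i : ℝ) + 2)) ≤
      ∏ i ∈ Finset.range M, (t + ((i : ℝ) + 2)) :=
    Finset.prod_le_prod (fun i _ => by positivity) fun i _ => by linarith
  have habs : |(-1 : ℝ) ^ (M + 2) * ∏ i ∈ Finset.range (M + 2), (x - (i : ℝ))| ≤
      (M + 1).factorial := by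
    rw [pow_succ, mul_neg_one, neg_mul, abs_neg, abs_of_nonneg h0]
    exact h1
  have hden : t ^ 2 * (t + 1) * ∏ i ∈ Finset.range M, (v + ((i : ℝ) + 2)) ≤
      (∏ i ∈ Finset.range (M + 2), (t + (i : ℝ))) * (t + x) := by
    rw [prod_range_add_two_add]
    calc _ ≤ t ^ 2 * (t + 1) * ∏ i ∈ Finset.range M, (t + ((i : ℝ) + 2)) := by gcongr
      _ = (t * (t + 1) * ∏ i ∈ Finset.range M, (t + ((i : ℝ) + 2))) * t := by ring
      _ ≤ _ := by
        have := hP.trans_le hPt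
        gcongr
        linarith
  have hpos : 0 < t ^ 2 * (t + 1) * ∏ i ∈ Finset.range M, (v + ((i : ℝ) + 2)) := by positivity
  rw [abs_div, abs_of_pos (hpos.trans_le hden)]
  calc _ ≤ ((M + 1).factorial : ℝ) /
        (t ^ 2 * (t + 1) * ∏ i ∈ Finset.range M, (v + ((i : ℝ) + 2))) := by gcongr
    _ = newtonRate v M * (1 / (t ^ 2 * (t + 1))) := by
      rw [newtonRate]; field_simp
    _ ≤ _ := by
      refine mul_le_mul_of_nonneg_left ?_ (newtonRate_pos hv M).le
      rw [div_sub_div _ _ (by positivity) (by positivity),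
        div_le_div_iff₀ (by positivity) (by positivity)]
      have : 0 ≤ t ^ 4 * (t + 1) ^ 1 * t := by positivity
      nlinarith [this, pow_pos ht 2, pow_pos ht 3, pow_pos ht 4]

theorem nonneg_of_hasDerivAt_nonpos_of_tendsto_zero {f f' : ℝ → ℝ} {v : ℝ}
    (hf : ∀ t, v ≤ t → HasDerivAt f (f' t) t) (hf' : ∀ t, v ≤ t → f' t ≤ 0)
    (hlim : Tendsto f atTop (nhds 0)) : 0 ≤ f v := by
  have hanti : AntitoneOn f (Set.Ici v) :=
    antitoneOn_of_deriv_nonpos (convex_Ici v)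
      (fun t ht => (hf t ht).continuousAt.continuousWithinAt)
      (fun t ht => (hf t (interior_subset ht)).differentiableAt.differentiableWithinAt)
      fun t ht => (hf t (interior_subset ht)).deriv.trans_le (hf' t (interior_subset ht))
  refine le_of_tendsto hlim ?_
  filter_upwards [eventually_ge_atTop v] with t ht
  exact hanti Set.self_mem_Ici ht ht

theorem abs_logNewtonRemainder_le (M : ℕ) {x v t : ℝ} (hx : x ∈ Set.Icc (0 : ℝ) 1)
    (hv : 0 < v) (hvt : v ≤ t) :
    |logNewtonRemainder (M + 2) x t| ≤ newtonRate v M * (1 / t - 1 / (t + 1)) := by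
  have hbound : ∀ s, t ≤ s → HasDerivAt (fun s => newtonRate v M * (1 / s - 1 / (s + 1)))
      (-(newtonRate v M * (1 / s ^ 2 - 1 / (s + 1) ^ 2))) s := fun s hs => by
    have hs0 : s ≠ 0 := by linarith
    have hs1 : s + 1 ≠ 0 := by linarith
    have h := ((hasDerivAt_inv hs0).sub
      (((hasDerivAt_id s).add_const 1).inv hs1)).const_mul (newtonRate v M)
    simp only [one_div]
    refine HasDerivAt.congr_deriv h ?_
    simp only [id]
    ring
  have hinv : Tendsto (fun s : ℝ => newtonRate v M * (1 / s - 1 / (s + 1))) atTop (nhds 0) := by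
    have h0 : Tendsto (fun s : ℝ => 1 / s) atTop (nhds 0) :=
      tendsto_const_nhds.div_atTop tendsto_id
    have h1 := h0.comp (tendsto_atTop_add_const_right _ (1 : ℝ) tendsto_id)
    simpa [Function.comp_def] using (h0.sub h1).const_mul (newtonRate v M)
  have hR := tendsto_logNewtonRemainder (M + 1) x
  have hd := fun s (hs : t ≤ s) =>
    hasDerivAt_logNewtonRemainder (M + 2) hx.1 (hv.trans_le (hvt.trans hs))
  have hle := fun s (hs : t ≤ s) =>
    abs_le.1 (abs_deriv_logNewtonRemainder_le M hx hv (hvt.trans hs))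
  have hsub := nonneg_of_hasDerivAt_nonpos_of_tendsto_zero
    (fun s hs => (hbound s hs).sub (hd s hs))
    (fun s hs => by linarith [(hle s hs).1]) (sub_zero (0 : ℝ) ▸ hinv.sub hR)
  have hadd := nonneg_of_hasDerivAt_nonpos_of_tendsto_zero
    (fun s hs => (hbound s hs).add (hd s hs))
    (fun s hs => by linarith [(hle s hs).2]) (add_zero (0 : ℝ) ▸ hinv.add hR)
  simp only [Pi.sub_apply, Pi.add_apply] at hsub hadd
  rw [abs_le]
  constructor <;> linarith

theorem gregoryG_zero : gregoryG 0 = 1 := by simp [gregoryG]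

theorem gregoryG_one : gregoryG 1 = 1 / 2 := by simp [gregoryG]

theorem abs_gregoryG_succ_s17 (n : ℕ) : |gregoryG (n + 1)| = (-1) ^ n * gregoryG (n + 1) := by
  have h : 0 ≤ (-1) ^ n * gregoryG (n + 1) := by
    rw [gregoryG, ← intervalIntegral.integral_const_mul]
    refine intervalIntegral.integral_nonneg zero_le_one fun x hx => ?_
    rw [← mul_div_assoc]
    exact div_nonneg (neg_one_pow_mul_prod_range_sub hx n).1 (by positivity)
  rw [← abs_of_nonneg h, abs_mul, abs_pow, abs_neg, abs_one, one_pow, one_mul]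

theorem integral_logNewtonRemainder (N : ℕ) {v : ℝ} (hv : 0 < v) :
    ∫ x in (0 : ℝ)..1, logNewtonRemainder (N + 1) x v =
      (v + 1) * Real.log (v + 1) - v * Real.log v - 1 - Real.log v +
        ∑ n ∈ Finset.range N, |gregoryG (n + 1)| * alternatingDiff Real.log (n + 1) v := by
  have hlog : IntervalIntegrable (fun x => Real.log (v + x)) MeasureTheory.volume 0 1 := by
    refine ContinuousOn.intervalIntegrable fun x hx => ?_
    rw [Set.uIcc_of_le zero_le_one] at hx
    have : v + x ≠ 0 := by linarith [hx.1]
    exact ((continuousAt_const.add continuousAt_id).log this).continuousWithinAt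
  have hterm : ∀ n ∈ Finset.range (N + 1), IntervalIntegrable
      (fun x : ℝ => (∏ i ∈ Finset.range n, (x - (i : ℝ))) / (n.factorial : ℝ) *
        ((-1) ^ n * alternatingDiff Real.log n v)) MeasureTheory.volume 0 1 := fun n _ =>
    (((continuous_finsetProd _ fun i _ => continuous_id.sub continuous_const).div_const
      _).mul_const _).intervalIntegrable _ _
  have hsum := IntervalIntegrable.sum (Finset.range (N + 1)) hterm
  simp only [logNewtonRemainder]
  rw [intervalIntegral.integral_sub hlog (by simpa [Finset.sum_fn] using hsum),
    intervalIntegral.integral_finsetSum hterm,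
    intervalIntegral.integral_comp_add_left (fun x => Real.log x), integral_log,
    Finset.sum_range_succ']
  simp only [intervalIntegral.integral_mul_const]
  change _ - (∑ n ∈ Finset.range N, gregoryG (n + 1) * _ + gregoryG 0 * _) = _
  rw [gregoryG_zero, alternatingDiff_zero, add_zero]
  have : ∑ n ∈ Finset.range N, gregoryG (n + 1) *
      ((-1) ^ (n + 1) * alternatingDiff Real.log (n + 1) v) =
      -∑ n ∈ Finset.range N, |gregoryG (n + 1)| * alternatingDiff Real.log (n + 1) v := by
    rw [← Finset.sum_neg_distrib]
    refine Finset.sum_congr rfl fun n _ => ?_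
    rw [abs_gregoryG_succ_s17]
    ring
  rw [this]
  ring

theorem abs_integral_logNewtonRemainder_le (M : ℕ) {v t : ℝ} (hv : 0 < v) (hvt : v ≤ t) :
    |∫ x in (0 : ℝ)..1, logNewtonRemainder (M + 2) x t| ≤
      newtonRate v M * (1 / t - 1 / (t + 1)) := by
  have h := intervalIntegral.norm_integral_le_of_norm_le_const (a := (0 : ℝ)) (b := 1)
    (f := fun x => logNewtonRemainder (M + 2) x t)
    (C := newtonRate v M * (1 / t - 1 / (t + 1))) fun x hx => by
      rw [Set.uIoc_of_le zero_le_one] at hx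
      exact abs_logNewtonRemainder_le M ⟨hx.1.le, hx.2⟩ hv hvt
  simpa using h

/-- Stirling's formula for `log Γ` along the sequence `v + n`. -/
theorem tendsto_log_Gamma_add_nat_sub_stirling {v : ℝ} (hv : 0 < v) :
    Tendsto (fun n : ℕ => Real.log (Real.Gamma (v + n)) -
      ((v + n) * Real.log (v + n) - (v + n) + 1 / 2 * Real.log (2 * Real.pi) -
        1 / 2 * Real.log (v + n))) atTop (nhds 0) := by
  rw [← tendsto_add_atTop_iff_nat 1]
  have hGamma : Tendsto (fun n : ℕ => Real.log (Real.Gamma (v + (n + 1 : ℕ))) -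
      v * Real.log n - Real.log n.factorial) atTop (nhds 0) := by
    have h := (Real.BohrMollerup.tendsto_log_gamma hv).const_sub (Real.log (Real.Gamma v))
    rw [sub_self] at h
    refine h.congr fun n => ?_
    have hadd := Real.BohrMollerup.f_add_nat_eq (f := fun y => Real.log (Real.Gamma y))
      (fun {y} hy => by
        rw [Real.Gamma_add_one hy.ne', Real.log_mul hy.ne' (Real.Gamma_pos_of_pos hy).ne',
          add_comm]) hv (n + 1)
    rw [hadd, Real.BohrMollerup.logGammaSeq]
    ring
  have hStirling : Tendsto (fun n : ℕ => Real.log n.factorial - 1 / 2 * Real.log (2 * n) -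
      n * Real.log (n / Real.exp 1)) atTop (nhds (1 / 2 * Real.log Real.pi)) := by
    have h := Stirling.tendsto_stirlingSeq_sqrt_pi.log (by positivity)
    rw [Real.log_sqrt Real.pi_pos.le, div_eq_inv_mul, ← one_div] at h
    exact h.congr Stirling.log_stirlingSeq_formula
  have hlog := (Real.tendsto_mul_log_one_add_div_atTop (v + 1)).comp tendsto_natCast_atTop_atTop
  have hlog' := ((tendsto_log_add_sub_log (v + 1)).comp
    (tendsto_natCast_atTop_atTop (R := ℝ))).const_mul (v + 1 / 2)
  have h := ((hGamma.add hStirling).sub (hlog.add hlog')).add_const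
    (v + 1 - 1 / 2 * Real.log Real.pi)
  have hzero : 0 + 1 / 2 * Real.log Real.pi - (v + 1 + (v + 1 / 2) * 0) +
      (v + 1 - 1 / 2 * Real.log Real.pi) = 0 := by ring
  rw [hzero] at h
  refine h.congr' ?_
  filter_upwards [eventually_gt_atTop 0] with n hn
  have hn' : (0 : ℝ) < n := by exact_mod_cast hn
  have hsplit : Real.log (1 + (v + 1) / n) = Real.log (v + (n + 1)) - Real.log n := by
    rw [← Real.log_div (by positivity) hn'.ne']
    congr 1
    field_simp
    ring
  simp only [Function.comp_apply]
  rw [hsplit, Real.log_mul two_ne_zero hn'.ne', Real.log_mul two_ne_zero Real.pi_ne_zero,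
    Real.log_div hn'.ne' (Real.exp_ne_zero 1), Real.log_exp,
    show (n : ℝ) + (v + 1) = v + (n + 1) by ring]
  push_cast
  ring

/-- The partial sums of the Gregory series for `log Γ`. -/
noncomputable def gregoryPartialSum (N : ℕ) (v : ℝ) : ℝ :=
  ∑ n ∈ Finset.range N, |gregoryG (n + 1)| * alternatingDiff Real.log n v

/-- The error of the partial sums of the Gregory series for `log Γ`. -/
noncomputable def gregoryError (N : ℕ) (v : ℝ) : ℝ :=
  v * Real.log v - v + (1 / 2) * Real.log (2 * Real.pi) - gregoryPartialSum N v -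
    Real.log (Real.Gamma v)

theorem gregoryError_add_one (N : ℕ) {v : ℝ} (hv : 0 < v) :
    gregoryError N (v + 1) - gregoryError N v =
      ∫ x in (0 : ℝ)..1, logNewtonRemainder (N + 1) x v := by
  have hS : gregoryPartialSum N v - gregoryPartialSum N (v + 1) =
      ∑ n ∈ Finset.range N, |gregoryG (n + 1)| * alternatingDiff Real.log (n + 1) v := by
    simp only [gregoryPartialSum, ← Finset.sum_sub_distrib, alternatingDiff_succ, mul_sub]
  rw [integral_logNewtonRemainder N hv, ← hS, gregoryError, gregoryError,
    Real.Gamma_add_one hv.ne', Real.log_mul hv.ne' (Real.Gamma_pos_of_pos hv).ne']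
  ring

theorem tendsto_gregoryError_add_nat (M : ℕ) {v : ℝ} (hv : 0 < v) :
    Tendsto (fun m : ℕ => gregoryError (M + 1) (v + m)) atTop (nhds 0) := by
  have hcast : Tendsto (fun m : ℕ => v + (m : ℝ)) atTop atTop :=
    tendsto_atTop_add_const_left _ v tendsto_natCast_atTop_atTop
  have h := ((tendsto_log_Gamma_add_nat_sub_stirling hv).add
    (tendsto_finsetSum (Finset.range M) fun n _ =>
      ((tendsto_alternatingDiff_log n).comp hcast).const_mul |gregoryG (n + 1 + 1)|)).neg
  simp only [mul_zero, Finset.sum_const_zero, add_zero, neg_zero] at h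
  refine h.congr fun m => ?_
  rw [gregoryError, gregoryPartialSum, Finset.sum_range_succ', zero_add, gregoryG_one,
    alternatingDiff_zero, abs_of_pos (by norm_num : (0 : ℝ) < 1 / 2)]
  simp only [Function.comp_apply]
  ring

theorem nonneg_of_succ_le_of_tendsto_zero {u : ℕ → ℝ} (hu : ∀ m, u (m + 1) ≤ u m)
    (hlim : Tendsto u atTop (nhds 0)) : 0 ≤ u 0 :=
  (antitone_nat_of_succ_le hu).le_of_tendsto hlim 0

theorem abs_gregoryError_le (M : ℕ) {v : ℝ} (hv : 0 < v) :
    |gregoryError (M + 1) v| ≤ newtonRate v M * (1 / v) := by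
  have hstep : ∀ m : ℕ, |gregoryError (M + 1) (v + (m + 1 : ℕ)) - gregoryError (M + 1) (v + m)| ≤
      newtonRate v M * (1 / (v + m)) - newtonRate v M * (1 / (v + (m + 1 : ℕ))) := fun m => by
    have hm : v ≤ v + (m : ℝ) := le_add_of_nonneg_right m.cast_nonneg
    have e : v + ((m + 1 : ℕ) : ℝ) = v + m + 1 := by push_cast; ring
    rw [e, gregoryError_add_one _ (hv.trans_le hm), ← mul_sub]
    exact abs_integral_logNewtonRemainder_le M hv hm
  have hinv : Tendsto (fun m : ℕ => newtonRate v M * (1 / (v + (m : ℝ)))) atTop (nhds 0) := by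
    have h0 : Tendsto (fun m : ℕ => 1 / (v + (m : ℝ))) atTop (nhds 0) :=
      tendsto_const_nhds.div_atTop
        (tendsto_atTop_add_const_left _ v tendsto_natCast_atTop_atTop)
    simpa using h0.const_mul (newtonRate v M)
  have herr := tendsto_gregoryError_add_nat M hv
  have hsub := nonneg_of_succ_le_of_tendsto_zero
    (fun m => by linarith [(abs_le.1 (hstep m)).1]) (sub_zero (0 : ℝ) ▸ hinv.sub herr)
  have hadd := nonneg_of_succ_le_of_tendsto_zero
    (fun m => by linarith [(abs_le.1 (hstep m)).2]) (add_zero (0 : ℝ) ▸ hinv.add herr)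
  simp only [Nat.cast_zero, add_zero] at hsub hadd
  rw [abs_le]
  constructor <;> linarith

theorem tendsto_gregoryPartialSum {v : ℝ} (hv : 0 < v) :
    Tendsto (fun N => gregoryPartialSum N v) atTop
      (nhds (v * Real.log v - v + (1 / 2) * Real.log (2 * Real.pi) -
        Real.log (Real.Gamma v))) := by
  rw [← tendsto_add_atTop_iff_nat 1]
  have herr : Tendsto (fun M => gregoryError (M + 1) v) atTop (nhds 0) :=
    squeeze_zero_norm (fun M => abs_gregoryError_le M hv)
      (by simpa using (tendsto_newtonRate hv).mul_const (1 / v))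
  have h := herr.const_sub (v * Real.log v - v + (1 / 2) * Real.log (2 * Real.pi) -
    Real.log (Real.Gamma v))
  rw [sub_zero] at h
  refine h.congr fun M => ?_
  rw [gregoryError]
  ring

/-- Series for the logarithm of the gamma function with Gregory's coefficients:
for real `v > 0`, the series `Σ_{n=0}^∞ |G_{n+1}| Σ_{k=0}^n (−1)^k C(n,k) ln(k+v)`
converges and
`ln Γ(v) = v ln v − v + (1/2) ln(2π) − Σ_{n=0}^∞ |G_{n+1}| Σ_{k=0}^n (−1)^k C(n,k) ln(k+v)`. -/
theorem logGamma_gregory_series (v : ℝ) (hv : 0 < v) :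
    ∃ L : ℝ,
      Tendsto (fun N : ℕ => ∑ n ∈ Finset.range N, |gregoryG (n + 1)| *
          ∑ k ∈ Finset.range (n + 1), (-1 : ℝ) ^ k * (n.choose k : ℝ) * Real.log ((k : ℝ) + v))
        atTop (nhds L) ∧
      Real.log (Real.Gamma v) =
        v * Real.log v - v + (1 / 2) * Real.log (2 * Real.pi) - L := by
  exact ⟨_, tendsto_gregoryPartialSum hv, by ring⟩
end
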